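/- arXiv:2406.01959 — 3 statements merged into one kernel-verified Lean document; each statement's English description precedes it below -/
import Mathlib

section
/- Let H be a finite-dimensional real inner product space, n ≥ 1 a natural number, and f_1, …, f_n : H → ℝ differentiable functions whose gradients are each L-Lipschitz; set F = (1/n)·∑_{i=1}^{n} f_i. Let g : Fin n → H, let v, x, x' ∈ H, let β ∈ [0, 1], and for each j ∈ Fin n define z_j = ∇f_j(x') - g(j) + (1/n)·∑_{i=1}^{n} g(i) and v'_j = (1-β)·v + β·z_j + (1-β)·(∇f_j(x') - ∇f_j(x)). Then (1/n)·∑_{j=1}^{n} ‖∇F(x') - v'_j‖² ≤ (1-β)·‖v - ∇F(x)‖² + 2β²·(1/n)·∑_{j=1}^{n} ‖z_j - ∇F(x')‖² + 2L²·‖x' - x‖². -/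
theorem aux_pt {H : Type*} [NormedAddCommGroup H] [InnerProductSpace ℝ H]
    (a p d D : H) (β R : ℝ) (hβ0 : 0 ≤ β) (hβ1 : β ≤ 1) (hd : ‖d‖ ^ 2 ≤ R) :
    ‖(1 - β) • a + (β • p + (1 - β) • (d - D))‖ ^ 2 ≤
      (1 - β) * ‖a‖ ^ 2 + 2 * β ^ 2 * ‖p‖ ^ 2 + 2 * R +
      (inner ℝ ((2 * (1 - β) * β) • a) p +
        inner ℝ ((2 * (1 - β) ^ 2) • a - (4 * (1 - β) ^ 2) • D) (d - D)) := by
  obtain ⟨e, rfl⟩ : ∃ e, d = e + D := ⟨d - D, by simp⟩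
  rw [add_sub_cancel_right]
  have h1 : 0 ≤ ‖β • p - (1 - β) • e‖ ^ 2 := by positivity
  rw [norm_add_sq_real] at hd
  rw [norm_sub_sq_real] at h1
  rw [norm_add_sq_real, norm_add_sq_real (β • p)]
  simp only [inner_add_right, inner_sub_left, inner_smul_left, inner_smul_right, norm_smul,
    mul_pow, Real.norm_eq_abs, sq_abs, RCLike.conj_to_real] at *
  rw [real_inner_comm e D] at *
  have h2 : (1 - β) ^ 2 ≤ 1 - β := by nlinarith
  have h3 : (1 - β) ^ 2 ≤ 1 := by nlinarith
  have hR : 0 ≤ R := by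
    have : 0 ≤ ‖e + D‖ ^ 2 := by positivity
    rw [norm_add_sq_real] at this
    linarith
  have h4 := mul_le_mul_of_nonneg_right h2 (sq_nonneg ‖a‖)
  have h5 := mul_le_mul_of_nonneg_right h3 hR
  have h6 := mul_le_mul_of_nonneg_left hd (sq_nonneg (1 - β))
  have h7 := mul_nonneg (sq_nonneg (1 - β)) (sq_nonneg ‖D‖)
  nlinarith

/-- One-step variance bound for the SAG-corrected STORM estimator in the
finite-sum setting. -/
theorem stmt_5 {H : Type*} [NormedAddCommGroup H] [InnerProductSpace ℝ H]
    [FiniteDimensional ℝ H]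
    (n : ℕ) (hn : 1 ≤ n) (f : Fin n → H → ℝ) (L : ℝ)
    (hdiff : ∀ i, Differentiable ℝ (f i))
    (hlip : ∀ i, ∀ x y : H, ‖gradient (f i) x - gradient (f i) y‖ ≤ L * ‖x - y‖)
    (F : H → ℝ) (hF : F = fun x => (n : ℝ)⁻¹ * ∑ i, f i x)
    (g : Fin n → H) (v x x' : H) (β : ℝ) (hβ0 : 0 ≤ β) (hβ1 : β ≤ 1)
    (z : Fin n → H)
    (hz : ∀ j, z j = gradient (f j) x' - g j + (n : ℝ)⁻¹ • ∑ i, g i)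
    (v' : Fin n → H)
    (hv' : ∀ j, v' j =
      (1 - β) • v + β • z j + (1 - β) • (gradient (f j) x' - gradient (f j) x)) :
    (n : ℝ)⁻¹ * ∑ j, ‖gradient F x' - v' j‖ ^ 2 ≤
      (1 - β) * ‖v - gradient F x‖ ^ 2 +
      2 * β ^ 2 * ((n : ℝ)⁻¹ * ∑ j, ‖z j - gradient F x'‖ ^ 2) +
      2 * L ^ 2 * ‖x' - x‖ ^ 2 := by
  have hn0 : (n : ℝ) ≠ 0 := by positivity
  have hgF : ∀ y, gradient F y = (n : ℝ)⁻¹ • ∑ i, gradient (f i) y := by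
    intro y
    apply HasGradientAt.gradient
    rw [hasGradientAt_iff_hasFDerivAt, hF]
    have h := (HasFDerivAt.fun_sum (u := Finset.univ)
      (fun i _ => ((hdiff i y).hasGradientAt).hasFDerivAt)).const_mul ((n : ℝ)⁻¹)
    have e : (InnerProductSpace.toDual ℝ H) ((n : ℝ)⁻¹ • ∑ i, gradient (f i) y) =
        (n : ℝ)⁻¹ • ∑ i, (InnerProductSpace.toDual ℝ H) (gradient (f i) y) := by
      simp [map_sum]
    rw [e]
    exact h
  have hsum : ∀ y, ∑ i, gradient (f i) y = (n : ℝ) • gradient F y := by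
    intro y
    rw [hgF, smul_inv_smul₀ hn0]
  set D := gradient F x' - gradient F x with hD
  have hp : ∑ j, (z j - gradient F x') = 0 := by
    simp only [hz, Finset.sum_sub_distrib, Finset.sum_add_distrib, hsum, Finset.sum_const,
      Finset.card_univ, Fintype.card_fin, ← Nat.cast_smul_eq_nsmul ℝ]
    rw [smul_inv_smul₀ hn0]
    abel
  have he : ∑ j, (gradient (f j) x' - gradient (f j) x - D) = 0 := by
    simp only [Finset.sum_sub_distrib, hsum, Finset.sum_const,
      Finset.card_univ, Fintype.card_fin, ← Nat.cast_smul_eq_nsmul ℝ, hD, smul_sub]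
    abel
  have hE : ∀ j, ‖gradient F x' - v' j‖ ^ 2 = ‖(1 - β) • (v - gradient F x) +
      (β • (z j - gradient F x') +
        (1 - β) • (gradient (f j) x' - gradient (f j) x - D))‖ ^ 2 := by
    intro j
    rw [norm_sub_rev, hv', hD]
    congr 2
    module
  simp only [hE]
  have key := fun j => aux_pt (v - gradient F x) (z j - gradient F x')
      (gradient (f j) x' - gradient (f j) x) D β (L ^ 2 * ‖x' - x‖ ^ 2) hβ0 hβ1 (by
        rw [← mul_pow]
        exact pow_le_pow_left₀ (norm_nonneg _) (hlip j x' x) 2)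
  have hs := Finset.sum_le_sum (fun j (_ : j ∈ Finset.univ) => key j)
  rw [Finset.sum_add_distrib, Finset.sum_add_distrib (f := fun j => inner ℝ _ (z j - _)),
    ← inner_sum, ← inner_sum, hp, he] at hs
  simp only [Finset.sum_add_distrib, ← Finset.mul_sum, Finset.sum_const, Finset.card_univ,
    Fintype.card_fin, nsmul_eq_mul, inner_zero_right, add_zero] at hs
  have h := mul_le_mul_of_nonneg_left hs (by positivity : 0 ≤ (n : ℝ)⁻¹)
  refine h.trans (le_of_eq ?_)
  field_simp
end

section
/- Let H be a finite-dimensional real inner product space, n ≥ 1 a natural number, and f_1, …, f_n : H → ℝ differentiable functions whose gradients are each L-Lipschitz. Let g : Fin n → H and x, x' ∈ H. For each k ∈ Fin n define g'_k : Fin n → H by g'_k(k) = ∇f_k(x) and g'_k(i) = g(i) for i ≠ k. Then (1/n²)·∑_{k=1}^{n} ∑_{j=1}^{n} ‖∇f_j(x') - g'_k(j)‖² ≤ 3·n·L²·‖x' - x‖² + (1 - 1/(2n))·(1/n)·∑_{j=1}^{n} ‖∇f_j(x) - g(j)‖². -/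
/-- One-step contraction of the SAG gradient table error after replacing the
uniformly random entry `k` by the fresh gradient `∇f_k(x)`. -/
theorem stmt_6 {H : Type*} [NormedAddCommGroup H] [InnerProductSpace ℝ H]
    [FiniteDimensional ℝ H]
    (n : ℕ) (hn : 1 ≤ n) (f : Fin n → H → ℝ) (L : ℝ)
    (hdiff : ∀ i, Differentiable ℝ (f i))
    (hlip : ∀ i, ∀ x y : H, ‖gradient (f i) x - gradient (f i) y‖ ≤ L * ‖x - y‖)
    (g : Fin n → H) (x x' : H) :
    ((n : ℝ) ^ 2)⁻¹ *
        ∑ k, ∑ j, ‖gradient (f j) x' - Function.update g k (gradient (f k) x) j‖ ^ 2 ≤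
      3 * n * L ^ 2 * ‖x' - x‖ ^ 2 +
      (1 - 1 / (2 * n)) * ((n : ℝ)⁻¹ * ∑ j, ‖gradient (f j) x - g j‖ ^ 2) := by
  have hn' : (1 : ℝ) ≤ n := by exact_mod_cast hn
  have key : ∀ j, ∑ k, ‖gradient (f j) x' - Function.update g k (gradient (f k) x) j‖ ^ 2 ≤
      3 * (n : ℝ) ^ 2 * (L ^ 2 * ‖x' - x‖ ^ 2) +
        ((n : ℝ) - 1 / 2) * ‖gradient (f j) x - g j‖ ^ 2 := by
    intro j
    have hD : ‖gradient (f j) x' - gradient (f j) x‖ ^ 2 ≤ L ^ 2 * ‖x' - x‖ ^ 2 := by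
      rw [← mul_pow]
      exact pow_le_pow_left₀ (norm_nonneg _) (hlip j x' x) 2
    have htri : ‖gradient (f j) x' - g j‖ ≤
        ‖gradient (f j) x' - gradient (f j) x‖ + ‖gradient (f j) x - g j‖ :=
      norm_sub_le_norm_sub_add_norm_sub _ _ _
    have hC := pow_le_pow_left₀ (norm_nonneg _) htri 2
    rw [← Finset.add_sum_erase _ _ (Finset.mem_univ j)]
    have hs : ∑ k ∈ Finset.univ.erase j,
        ‖gradient (f j) x' - Function.update g k (gradient (f k) x) j‖ ^ 2 =
        ((n : ℝ) - 1) * ‖gradient (f j) x' - g j‖ ^ 2 := by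
      rw [Finset.sum_congr rfl (g := fun _ => ‖gradient (f j) x' - g j‖ ^ 2)]
      · rw [Finset.sum_const, Finset.card_erase_of_mem (Finset.mem_univ j), Finset.card_univ,
          Fintype.card_fin, nsmul_eq_mul, Nat.cast_sub hn, Nat.cast_one]
      · intro k hk
        rw [Function.update_of_ne (Finset.ne_of_mem_erase hk).symm]
    rw [hs, Function.update_self]
    generalize ‖gradient (f j) x' - g j‖ = c at *
    generalize ‖gradient (f j) x' - gradient (f j) x‖ = a at *
    generalize ‖gradient (f j) x - g j‖ = b at *
    generalize L ^ 2 * ‖x' - x‖ ^ 2 = D at *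
    have h1 := mul_le_mul_of_nonneg_left hC (sub_nonneg.2 hn')
    have h2 : (3 * (n : ℝ) ^ 2) * a ^ 2 ≤ 3 * (n : ℝ) ^ 2 * D :=
      mul_le_mul_of_nonneg_left hD (by positivity)
    have h3 : 0 ≤ ((n : ℝ) ^ 2 + 3 * n - 2) * a ^ 2 :=
      mul_nonneg (by nlinarith) (sq_nonneg a)
    nlinarith [sq_nonneg (2 * ((n : ℝ) - 1) * a - b)]
  rw [Finset.sum_comm]
  have hsum := Finset.sum_le_sum (fun j (_ : j ∈ Finset.univ) => key j)
  rw [Finset.sum_add_distrib, Finset.sum_const, ← Finset.mul_sum, Finset.card_univ,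
    Fintype.card_fin, nsmul_eq_mul] at hsum
  refine (mul_le_mul_of_nonneg_left hsum (by positivity)).trans (le_of_eq ?_)
  have : (n : ℝ) ≠ 0 := by positivity
  field_simp
end

section
/- Let H be a finite-dimensional real inner product space, n ≥ 1 a natural number, and f_1, …, f_n : H → ℝ differentiable functions whose gradients are each L-Lipschitz; set F = (1/n)·∑_{i=1}^{n} f_i. Then for all x, y ∈ H: (1/n)·∑_{i=1}^{n} ‖∇F(x) - (∇f_i(x) - ∇f_i(y) + ∇F(y))‖² ≤ L²·‖x - y‖². -/
/-- Variance bound for the SVRG control-variate gradient estimator anchored at `y`. -/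
theorem stmt_7 {H : Type*} [NormedAddCommGroup H] [InnerProductSpace ℝ H]
    [FiniteDimensional ℝ H]
    (n : ℕ) (hn : 1 ≤ n) (f : Fin n → H → ℝ) (L : ℝ)
    (hdiff : ∀ i, Differentiable ℝ (f i))
    (hlip : ∀ i, ∀ x y : H, ‖gradient (f i) x - gradient (f i) y‖ ≤ L * ‖x - y‖)
    (F : H → ℝ) (hF : F = fun x => (n : ℝ)⁻¹ * ∑ i, f i x)
    (x y : H) :
    (n : ℝ)⁻¹ *
        ∑ i, ‖gradient F x - (gradient (f i) x - gradient (f i) y + gradient F y)‖ ^ 2 ≤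
      L ^ 2 * ‖x - y‖ ^ 2 := by
  have hn0 : (n : ℝ) ≠ 0 := by
    have : n ≠ 0 := by omega
    exact_mod_cast this
  have hnpos : (0 : ℝ) < n := by
    have : 0 < n := by omega
    exact_mod_cast this
  have hg : ∀ z, gradient F z = (n : ℝ)⁻¹ • ∑ i, gradient (f i) z := by
    intro z
    have h1 : HasFDerivAt F ((n : ℝ)⁻¹ • ∑ i, fderiv ℝ (f i) z) z := by
      rw [hF]
      exact (HasFDerivAt.fun_sum (fun i _ => ((hdiff i) z).hasFDerivAt)).const_mul _
    unfold gradient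
    rw [h1.fderiv]
    simp [map_sum]
  set d : Fin n → H := fun i => gradient (f i) x - gradient (f i) y with hd
  set m : H := (n : ℝ)⁻¹ • ∑ i, d i with hm
  have hsum : ∑ i, d i = (n : ℝ) • m := by
    rw [hm, smul_smul, mul_inv_cancel₀ hn0, one_smul]
  have he : ∀ i, gradient F x - (gradient (f i) x - gradient (f i) y + gradient F y)
      = m - d i := by
    intro i
    rw [hg x, hg y, hm]
    simp only [hd, Finset.sum_sub_distrib, smul_sub]
    abel
  have hv : ∑ i, ‖m - d i‖ ^ 2 = ∑ i, ‖d i‖ ^ 2 - n * ‖m‖ ^ 2 := by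
    simp only [norm_sub_sq_real, Finset.sum_add_distrib, Finset.sum_sub_distrib,
      ← Finset.mul_sum, ← inner_sum]
    rw [hsum, inner_smul_right, real_inner_self_eq_norm_sq]
    simp
    ring
  have hb : ∑ i, ‖d i‖ ^ 2 ≤ n * (L ^ 2 * ‖x - y‖ ^ 2) := by
    calc ∑ i, ‖d i‖ ^ 2 ≤ ∑ _i : Fin n, (L ^ 2 * ‖x - y‖ ^ 2) := by
          apply Finset.sum_le_sum
          intro i _
          rw [← mul_pow]
          exact pow_le_pow_left₀ (norm_nonneg _) (hlip i x y) 2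
      _ = _ := by simp
  simp only [he]
  rw [hv, inv_mul_le_iff₀ hnpos]
  have : 0 ≤ (n : ℝ) * ‖m‖ ^ 2 := by positivity
  linarith
end
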